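/- Conservation of the canonical dilation current (Charap–Tait): let L be a first-order Lagrangian that is dilation invariant for scaling dimensions d₁, …, d_m, and let χ : U → ℝ^m be on shell. Then the canonical dilation current Δ^μ(x) = Σ_a (∂L/∂p^a_μ)(χ(x), ∂χ(x)) · ( d_a χ^a(x) + x^ν ∂_ν χ^a(x) ) − x^μ L(χ(x), ∂χ(x)) is conserved on U: ∂_μ Δ^μ = 0. Moreover Δ^μ decomposes as Δ^μ = J^μ + T^μ_ν x^ν into the internal dilation current J^μ = Σ_a (∂L/∂p^a_μ) d_a χ^a and the canonical energy–momentum current T^μ_ν = Σ_a (∂L/∂p^a_μ) ∂_ν χ^a − δ^μ_ν L. -/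

import Mathlib

noncomputable section

open scoped BigOperators

/-- Partial derivative `∂_μ f` of a real-valued function on `ℝⁿ`. -/
def pd {n : ℕ} (μ : Fin n) (f : (Fin n → ℝ) → ℝ) : (Fin n → ℝ) → ℝ :=
  fun x => fderiv ℝ f x (Pi.single μ 1)

/-- Partial derivative `∂_μ f` of a complex-valued function on `ℝⁿ`. -/
def pdC {n : ℕ} (μ : Fin n) (f : (Fin n → ℝ) → ℂ) : (Fin n → ℝ) → ℂ :=
  fun x => fderiv ℝ f x (Pi.single μ 1)

/-- Christoffel symbols `_gΓ^μ_{νλ}` of the metric `g` (with inverse `ginv`). -/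
def christoffel {n : ℕ} (g ginv : (Fin n → ℝ) → Fin n → Fin n → ℝ)
    (μ ν lam : Fin n) (x : Fin n → ℝ) : ℝ :=
  (1/2) * ∑ κ, ginv x μ κ *
    (pd ν (fun y => g y κ lam) x + pd lam (fun y => g y κ ν) x - pd κ (fun y => g y ν lam) x)

/-- Weylian affine connection `Γ^μ_{νλ}` of the Weylian metric `(g, φ)`:
`Γ^μ_{νλ} = _gΓ^μ_{νλ} + δ^μ_ν φ_λ + δ^μ_λ φ_ν − g_{νλ} φ^μ`. -/
def weylConn {n : ℕ} (g ginv : (Fin n → ℝ) → Fin n → Fin n → ℝ)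
    (φ : (Fin n → ℝ) → Fin n → ℝ) (μ ν lam : Fin n) (x : Fin n → ℝ) : ℝ :=
  christoffel g ginv μ ν lam x
    + (if ν = μ then φ x lam else 0) + (if lam = μ then φ x ν else 0)
    - g x ν lam * ∑ κ, ginv x μ κ * φ x κ

/-- Curvature tensor `R^μ_{νλκ}` of a family of connection coefficients `Γ`. -/
def curvOf {n : ℕ} (Γ : (Fin n → ℝ) → Fin n → Fin n → Fin n → ℝ)
    (μ ν lam κ : Fin n) (x : Fin n → ℝ) : ℝ :=
  pd lam (fun y => Γ y μ ν κ) x - pd κ (fun y => Γ y μ ν lam) x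
    + ∑ σ, Γ x μ lam σ * Γ x σ ν κ - ∑ σ, Γ x μ κ σ * Γ x σ ν lam

/-- Ricci tensor `R_{νκ} = R^μ_{νμκ}`. -/
def ricciOf {n : ℕ} (Γ : (Fin n → ℝ) → Fin n → Fin n → Fin n → ℝ)
    (ν κ : Fin n) (x : Fin n → ℝ) : ℝ :=
  ∑ μ, curvOf Γ μ ν μ κ x

/-- Scalar curvature `R = g^{νκ} R_{νκ}`. -/
def scalarOf {n : ℕ} (ginv : (Fin n → ℝ) → Fin n → Fin n → ℝ)
    (Γ : (Fin n → ℝ) → Fin n → Fin n → Fin n → ℝ) (x : Fin n → ℝ) : ℝ :=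
  ∑ ν, ∑ κ, ginv x ν κ * ricciOf Γ ν κ x

/-- Volume factor `√|det g|`. -/
def volFac {n : ℕ} (g : (Fin n → ℝ) → Fin n → Fin n → ℝ) (x : Fin n → ℝ) : ℝ :=
  Real.sqrt |Matrix.det (Matrix.of (g x))|

/-- Laplace–Beltrami operator `Δ_g f = (1/√|det g|) ∂_μ ( √|det g| g^{μν} ∂_ν f )`. -/
def laplaceBeltrami {n : ℕ} (g ginv : (Fin n → ℝ) → Fin n → Fin n → ℝ)
    (f : (Fin n → ℝ) → ℝ) (x : Fin n → ℝ) : ℝ :=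
  (volFac g x)⁻¹ * ∑ μ, pd μ (fun y => volFac g y * ∑ ν, ginv y μ ν * pd ν f y) x

/-- Minkowski matrix `η = diag(1, −1, −1, −1)`. -/
def etaM : Fin 4 → Fin 4 → ℝ :=
  fun μ ν => if μ = ν then (if μ = 0 then 1 else -1) else 0

section PartialDerivatives

variable {n : ℕ} {μ : Fin n} {f g : (Fin n → ℝ) → ℝ} {x : Fin n → ℝ}

theorem pd_mul (hf : DifferentiableAt ℝ f x) (hg : DifferentiableAt ℝ g x) :
    pd μ (fun y => f y * g y) x = pd μ f x * g x + f x * pd μ g x := by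
  simp only [pd]
  rw [fderiv_fun_mul hf hg]
  simp
  ring

theorem pd_add (hf : DifferentiableAt ℝ f x) (hg : DifferentiableAt ℝ g x) :
    pd μ (fun y => f y + g y) x = pd μ f x + pd μ g x := by
  simp only [pd]
  rw [fderiv_fun_add hf hg]
  simp

theorem pd_sub (hf : DifferentiableAt ℝ f x) (hg : DifferentiableAt ℝ g x) :
    pd μ (fun y => f y - g y) x = pd μ f x - pd μ g x := by
  simp only [pd]
  rw [fderiv_fun_sub hf hg]
  simp

theorem pd_sum {ι : Type*} [Fintype ι] {F : ι → (Fin n → ℝ) → ℝ}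
    (hF : ∀ i, DifferentiableAt ℝ (F i) x) :
    pd μ (fun y => ∑ i, F i y) x = ∑ i, pd μ (F i) x := by
  simp only [pd]
  rw [fderiv_fun_sum fun i _ => hF i]
  simp

theorem pd_const_mul (c : ℝ) (hf : DifferentiableAt ℝ f x) :
    pd μ (fun y => c * f y) x = c * pd μ f x := by
  simp only [pd]
  rw [fderiv_const_mul hf]
  simp

theorem pd_coord (ν : Fin n) : pd μ (fun y => y ν) x = if μ = ν then 1 else 0 := by
  simp only [pd]
  rw [(hasFDerivAt_apply ν x).fderiv]
  simp [Pi.single_apply, eq_comm]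

/-- The partial derivatives of a smooth function are smooth. -/
theorem ContDiffAt.pd (hf : ContDiffAt ℝ (⊤ : ℕ∞) f x) (μ : Fin n) :
    ContDiffAt ℝ (⊤ : ℕ∞) (pd μ f) x :=
  (hf.fderiv_right (m := (⊤ : ℕ∞)) (by simp)).clm_apply contDiffAt_const

/-- Partial derivatives of a smooth function commute. -/
theorem pd_comm (hf : ContDiffAt ℝ (⊤ : ℕ∞) f x) (μ ν : Fin n) :
    pd μ (pd ν f) x = pd ν (pd μ f) x := by
  have hd : DifferentiableAt ℝ (fderiv ℝ f) x :=
    (hf.fderiv_right (m := (⊤ : ℕ∞)) (by simp)).differentiableAt (by simp)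
  have hs : IsSymmSndFDerivAt ℝ f x := hf.isSymmSndFDerivAt (by
    simpa using WithTop.coe_le_coe.2 (le_top : (2 : ℕ∞) ≤ ⊤))
  have key (v w : Fin n → ℝ) :
      fderiv ℝ (fun y => fderiv ℝ f y v) x w = fderiv ℝ (fderiv ℝ f) x w v := by
    rw [fderiv_clm_apply hd (differentiableAt_const v)]
    simp
  exact (key _ _).trans ((hs _ _).trans (key _ _).symm)

end PartialDerivatives

section Lagrangian

variable {m n : ℕ}

/-- A linear functional on field values and gradients, expanded in coordinates. -/
theorem apply_eq_sum_coord (T : (Fin m → ℝ) × (Fin m → Fin n → ℝ) →L[ℝ] ℝ)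
    (v : Fin m → ℝ) (q : Fin m → Fin n → ℝ) :
    T (v, q) = (∑ a, v a * T (Pi.single a 1, 0))
      + ∑ a, ∑ μ, q a μ * T (0, Pi.single a (Pi.single μ 1)) := by
  have hv : ((v, q) : (Fin m → ℝ) × (Fin m → Fin n → ℝ))
      = (∑ a, v a • (Pi.single a 1, 0))
        + ∑ a, ∑ μ, q a μ • (0, Pi.single a (Pi.single μ 1)) := by
    ext a
    · simp [Prod.fst_sum, Finset.sum_apply, Pi.single_apply]
    · rename_i μ
      simp [Prod.snd_sum, Finset.sum_apply, Pi.single_apply, apply_ite]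
  rw [hv]
  simp only [map_add, map_sum, map_smul, smul_eq_mul]

/-- Euler's identity for a dilation-invariant Lagrangian, differentiated along the dilation
flow. -/
theorem fderiv_dilation_eq {L : (Fin m → ℝ) × (Fin m → Fin n → ℝ) → ℝ} {d : Fin m → ℝ} {c : ℝ}
    {u : Fin m → ℝ} {p : Fin m → Fin n → ℝ} (hL : DifferentiableAt ℝ L (u, p))
    (hdil : ∀ ε : ℝ,
      L (fun a => Real.exp (d a * ε) * u a, fun a μ => Real.exp ((d a + 1) * ε) * p a μ)
        = Real.exp (c * ε) * L (u, p)) :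
    fderiv ℝ L (u, p) (fun a => d a * u a, fun a μ => (d a + 1) * p a μ) = c * L (u, p) := by
  have hexp (k : ℝ) (b : ℝ) :
      HasDerivAt (fun ε : ℝ => Real.exp (k * ε) * b) (k * b) 0 := by
    simpa using ((((hasDerivAt_id (0 : ℝ)).const_mul k).exp).mul_const b)
  have hγ : HasDerivAt
      (fun ε : ℝ => ((fun a => Real.exp (d a * ε) * u a,
        fun a μ => Real.exp ((d a + 1) * ε) * p a μ) : (Fin m → ℝ) × (Fin m → Fin n → ℝ)))
      (fun a => d a * u a, fun a μ => (d a + 1) * p a μ) 0 :=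
    (hasDerivAt_pi.2 fun a => hexp _ _).prodMk
      (hasDerivAt_pi.2 fun a => hasDerivAt_pi.2 fun μ => hexp _ _)
  have hL' : HasFDerivAt L (fderiv ℝ L (u, p))
      ((fun ε : ℝ => ((fun a => Real.exp (d a * ε) * u a,
        fun a μ => Real.exp ((d a + 1) * ε) * p a μ) :
          (Fin m → ℝ) × (Fin m → Fin n → ℝ))) 0) := by
    simpa using hL.hasFDerivAt
  have h := hL'.comp_hasDerivAt (0 : ℝ) hγ
  refine h.unique ((hexp c (L (u, p))).congr_of_eventuallyEq ?_)
  exact Filter.Eventually.of_forall hdil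

/-- Chain rule for the Lagrangian density along a field and its gradient. -/
theorem pd_comp_field {k : ℕ} {L : (Fin m → ℝ) × (Fin m → Fin n → ℝ) → ℝ}
    {u : (Fin k → ℝ) → Fin m → ℝ} {p : (Fin k → ℝ) → Fin m → Fin n → ℝ} {x : Fin k → ℝ}
    (hL : DifferentiableAt ℝ L (u x, p x)) (hu : ∀ a, DifferentiableAt ℝ (fun y => u y a) x)
    (hp : ∀ a ν, DifferentiableAt ℝ (fun y => p y a ν) x) (μ : Fin k) :
    pd μ (fun y => L (u y, p y)) x
      = fderiv ℝ L (u x, p x)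
          (fun a => pd μ (fun y => u y a) x, fun a ν => pd μ (fun y => p y a ν) x) := by
  have hup := (hasFDerivAt_pi.2 fun a => (hu a).hasFDerivAt).prodMk
    (hasFDerivAt_pi.2 fun a => hasFDerivAt_pi.2 fun ν => (hp a ν).hasFDerivAt)
  have h := HasFDerivAt.comp x (f := fun y => (u y, p y)) hL.hasFDerivAt hup
  simp only [pd]
  rw [show (fun y => L (u y, p y)) = L ∘ fun y => (u y, p y) from rfl, h.fderiv]
  rfl

end Lagrangian

/-- Conservation of the canonical dilation current (Charap–Tait): for a
first-order dilation-invariant Lagrangian `L` with scaling dimensions `d` and an on-shell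
field `χ`, the canonical dilation current
`Δ^μ = Σ_a (∂L/∂p^a_μ)(d_a χ^a + x^ν ∂_ν χ^a) − x^μ L` is conserved, `∂_μ Δ^μ = 0` on `U`,
and decomposes as `Δ^μ = J^μ + T^μ_ν x^ν` with `J^μ = Σ_a (∂L/∂p^a_μ) d_a χ^a` and
`T^μ_ν = Σ_a (∂L/∂p^a_μ) ∂_ν χ^a − δ^μ_ν L`. -/
theorem dilation_current_conservation (m : ℕ)
    (U : Set (Fin 4 → ℝ)) (hU : IsOpen U) (hUne : U.Nonempty)
    (L : (Fin m → ℝ) × (Fin m → Fin 4 → ℝ) → ℝ) (hL : ContDiff ℝ (⊤ : ℕ∞) L)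
    (d : Fin m → ℝ)
    (hdil : ∀ ε : ℝ, ∀ u : Fin m → ℝ, ∀ p : Fin m → Fin 4 → ℝ,
      L (fun a => Real.exp (d a * ε) * u a, fun a μ => Real.exp ((d a + 1) * ε) * p a μ)
        = Real.exp (4 * ε) * L (u, p))
    (χ : (Fin 4 → ℝ) → Fin m → ℝ)
    (hχ : ∀ a, ContDiffOn ℝ (⊤ : ℕ∞) (fun x => χ x a) U)
    (Dχ : (Fin 4 → ℝ) → Fin m → Fin 4 → ℝ)
    (hDχ : ∀ x a μ, Dχ x a μ = pd μ (fun y => χ y a) x)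
    (Lu : (Fin m → ℝ) × (Fin m → Fin 4 → ℝ) → Fin m → ℝ)
    (hLu : ∀ up a, Lu up a = fderiv ℝ L up (Pi.single a 1, 0))
    (Lp : (Fin m → ℝ) × (Fin m → Fin 4 → ℝ) → Fin m → Fin 4 → ℝ)
    (hLp : ∀ up a μ, Lp up a μ = fderiv ℝ L up (0, Pi.single a (Pi.single μ 1)))
    (onshell : ∀ a, ∀ x ∈ U,
      ∑ μ, pd μ (fun y => Lp (χ y, Dχ y) a μ) x = Lu (χ x, Dχ x) a)
    (Δ : (Fin 4 → ℝ) → Fin 4 → ℝ)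
    (hΔ : ∀ x μ, Δ x μ
      = (∑ a, Lp (χ x, Dχ x) a μ * (d a * χ x a + ∑ ν, x ν * Dχ x a ν))
        - x μ * L (χ x, Dχ x)) :
    (∀ x ∈ U, ∑ μ, pd μ (fun y => Δ y μ) x = 0)
    ∧ (∀ x, ∀ μ, Δ x μ
        = (∑ a, Lp (χ x, Dχ x) a μ * (d a * χ x a))
          + ∑ ν, (∑ a, Lp (χ x, Dχ x) a μ * Dχ x a ν
              - if μ = ν then L (χ x, Dχ x) else 0) * x ν) := by
  refine ⟨fun x hx => ?_, fun x μ => ?_⟩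
  · have hUx : U ∈ nhds x := hU.mem_nhds hx
    have hχx (a) : ContDiffAt ℝ (⊤ : ℕ∞) (fun y => χ y a) x := (hχ a).contDiffAt hUx
    have hDeq (a μ) : (fun y => Dχ y a μ) = pd μ (fun y => χ y a) :=
      funext fun y => hDχ y a μ
    have hDx (a μ) : ContDiffAt ℝ (⊤ : ℕ∞) (fun y => Dχ y a μ) x := by
      rw [hDeq]
      exact (hχx a).pd μ
    have hχd (a) : DifferentiableAt ℝ (fun y => χ y a) x := (hχx a).differentiableAt (by simp)
    have hDd (a μ) : DifferentiableAt ℝ (fun y => Dχ y a μ) x :=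
      (hDx a μ).differentiableAt (by simp)
    have hup : ContDiffAt ℝ (⊤ : ℕ∞) (fun y => (χ y, Dχ y)) x :=
      (contDiffAt_pi.2 hχx).prodMk (contDiffAt_pi.2 fun a => contDiffAt_pi.2 (hDx a))
    have hLd : DifferentiableAt ℝ L (χ x, Dχ x) := hL.contDiffAt.differentiableAt (by simp)
    have hLχd : DifferentiableAt ℝ (fun y => L (χ y, Dχ y)) x :=
      (hL.contDiffAt.comp x hup).differentiableAt (by simp)
    have hPd (a μ) : DifferentiableAt ℝ (fun y => Lp (χ y, Dχ y) a μ) x := by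
      simp only [hLp]
      have hL' : ContDiff ℝ (⊤ : ℕ∞) (fderiv ℝ L) := hL.fderiv_right (by simp)
      exact ((hL'.contDiffAt.comp x hup).clm_apply contDiffAt_const).differentiableAt (by simp)
    have hxd (ν : Fin 4) : DifferentiableAt ℝ (fun y : Fin 4 → ℝ => y ν) x :=
      differentiableAt_apply ν x
    have hsd (a) : DifferentiableAt ℝ (fun y => ∑ ν, y ν * Dχ y a ν) x :=
      DifferentiableAt.fun_sum fun ν _ => (hxd ν).fun_mul (hDd a ν)
    have hvd (a) : DifferentiableAt ℝ (fun y => d a * χ y a + ∑ ν, y ν * Dχ y a ν) x :=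
      ((hχd a).const_mul _).add (hsd a)
    have hsymm (a μ ν) : pd μ (fun y => Dχ y a ν) x = pd ν (fun y => Dχ y a μ) x := by
      rw [hDeq, hDeq]
      exact pd_comm (hχx a) μ ν
    have hexpand (v : Fin m → ℝ) (q : Fin m → Fin 4 → ℝ) :
        fderiv ℝ L (χ x, Dχ x) (v, q) = (∑ a, v a * Lu (χ x, Dχ x) a)
          + ∑ a, ∑ μ, q a μ * Lp (χ x, Dχ x) a μ := by
      simp only [hLu, hLp]
      exact apply_eq_sum_coord _ v q
    have heuler := fderiv_dilation_eq hLd fun ε => hdil ε (χ x) (Dχ x)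
    have hchain (μ) := pd_comp_field hLd hχd hDd μ
    rw [hexpand] at heuler
    simp only [hexpand, ← hDχ] at hchain
    have hterm (μ) : pd μ (fun y => Δ y μ) x
        = (∑ a, (pd μ (fun y => Lp (χ y, Dχ y) a μ) x * (d a * χ x a + ∑ ν, x ν * Dχ x a ν)
            + (d a + 1) * Dχ x a μ * Lp (χ x, Dχ x) a μ
            + ∑ ν, x ν * (pd ν (fun y => Dχ y a μ) x * Lp (χ x, Dχ x) a μ)))
          - (L (χ x, Dχ x) + x μ * ((∑ a, Dχ x a μ * Lu (χ x, Dχ x) a)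
            + ∑ a, ∑ ν, pd μ (fun y => Dχ y a ν) x * Lp (χ x, Dχ x) a ν)) := by
      simp only [hΔ]
      rw [pd_sub (DifferentiableAt.fun_sum fun a _ => (hPd a μ).fun_mul (hvd a))
        ((hxd μ).fun_mul hLχd), pd_sum fun a => (hPd a μ).fun_mul (hvd a), pd_mul (hxd μ) hLχd, hchain,
        pd_coord]
      congr 1
      · refine Finset.sum_congr rfl fun a _ => ?_
        rw [pd_mul (hPd a μ) (hvd a), pd_add ((hχd a).const_mul _) (hsd a),
          pd_const_mul _ (hχd a), pd_sum fun ν => (hxd ν).fun_mul (hDd a ν), ← hDχ]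
        simp only [fun ν => pd_mul (μ := μ) (hxd ν) (hDd a ν), pd_coord, hsymm a μ,
          Finset.sum_add_distrib, ite_mul, one_mul, zero_mul, Finset.sum_ite_eq,
          Finset.mem_univ, if_true, ← mul_assoc, ← Finset.sum_mul]
        ring
      · simp
    have honshell : ∑ μ, ∑ a,
        pd μ (fun y => Lp (χ y, Dχ y) a μ) x * (d a * χ x a + ∑ ν, x ν * Dχ x a ν)
          = (∑ a, d a * χ x a * Lu (χ x, Dχ x) a)
            + ∑ μ, x μ * ∑ a, Dχ x a μ * Lu (χ x, Dχ x) a := by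
      rw [Finset.sum_comm]
      simp only [← Finset.sum_mul, onshell _ x hx]
      simp only [Finset.mul_sum (Finset.univ : Finset (Fin m))]
      rw [Finset.sum_comm (s := (Finset.univ : Finset (Fin 4))), ← Finset.sum_add_distrib]
      refine Finset.sum_congr rfl fun a _ => ?_
      rw [mul_add, Finset.mul_sum]
      congr 1
      · ring
      · exact Finset.sum_congr rfl fun ν _ => by ring
    have hsecond : ∑ μ, ∑ a, ∑ ν, x ν * (pd ν (fun y => Dχ y a μ) x * Lp (χ x, Dχ x) a μ)
        = ∑ μ, x μ * ∑ a, ∑ ν, pd μ (fun y => Dχ y a ν) x * Lp (χ x, Dχ x) a ν := by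
      simp only [Finset.mul_sum]
      rw [Finset.sum_comm, Finset.sum_comm (s := (Finset.univ : Finset (Fin 4)))
        (t := (Finset.univ : Finset (Fin m)))]
      exact Finset.sum_congr rfl fun a _ => Finset.sum_comm
    have hfirst : ∑ μ, ∑ a, (d a + 1) * Dχ x a μ * Lp (χ x, Dχ x) a μ
        = ∑ a, ∑ μ, (d a + 1) * Dχ x a μ * Lp (χ x, Dχ x) a μ := Finset.sum_comm
    have hsplit (A B : Fin 4 → ℝ) :
        ∑ μ, x μ * (A μ + B μ) = (∑ μ, x μ * A μ) + ∑ μ, x μ * B μ := by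
      simp only [mul_add, Finset.sum_add_distrib]
    simp only [hterm, Finset.sum_sub_distrib, Finset.sum_add_distrib, hsplit, honshell, hsecond,
      hfirst, Finset.sum_const, Finset.card_univ, Fintype.card_fin, nsmul_eq_mul]
    push_cast
    linarith
  · rw [hΔ]
    simp only [sub_mul, Finset.sum_sub_distrib, ite_mul, zero_mul, Finset.sum_ite_eq,
      Finset.mem_univ, if_true, mul_add, Finset.sum_add_distrib, Finset.mul_sum, Finset.sum_mul]
    rw [Finset.sum_comm (γ := Fin m), add_sub_assoc, mul_comm (x μ)]
    congr 2
    exact Finset.sum_congr rfl fun ν _ => Finset.sum_congr rfl fun a _ => by ring
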